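/- Let (g,B) and (g',B') be quadratic Lie algebras with double-extension data (X0,Y0) and (X0',Y0') respectively, and set q := {x in g : B(x,X0) = B(x,Y0) = 0} and q' := {x' in g' : B'(x',X0') = B'(x',Y0') = 0} (note that [Y0,x] lies in q for every x in q, and similarly for q'). Then there exists a Lie algebra isomorphism A : g → g' satisfying B'(A(x),A(y)) = B(x,y) for all x,y in g if and only if there exist λ in ℂ with λ ≠ 0 and a linear bijection Ā : q → q' such that B'(Ā(x),Ā(y)) = B(x,y) for all x,y in q and [Y0', Ā(x)] = λ·Ā([Y0, x]) for all x in q. -/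

import Mathlib

/-- The subspace `{x ∈ g : B(x,X0) = B(x,Y0) = 0}`, the orthogonal of `span{X0,Y0}`. -/
noncomputable def orthoPair {g : Type*} [LieRing g] [LieAlgebra ℂ g]
    (B : LinearMap.BilinForm ℂ g) (X0 Y0 : g) : Submodule ℂ g :=
  LinearMap.ker (B.flip X0) ⊓ LinearMap.ker (B.flip Y0)

section SymmetricForm

variable {V : Type*} [AddCommGroup V] [Module ℂ V]

theorem eq_of_forall_form_eq {B : LinearMap.BilinForm ℂ V} (hB : B.Nondegenerate) {a b : V}
    (h : ∀ z, B a z = B b z) : a = b := by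
  rw [← sub_eq_zero]
  exact hB.1 _ fun z => by simp [h z]

/-- Two isotropic vectors which are not orthogonal are swapped by the reflection along their
difference. -/
theorem exists_reflection_swap {B : LinearMap.BilinForm ℂ V} (hsymm : ∀ x y, B x y = B y x)
    {p r : V} (hp : B p p = 0) (hr : B r r = 0) (hpr : B p r ≠ 0) :
    ∃ T : V ≃ₗ[ℂ] V, (∀ x y, B (T x) (T y) = B x y) ∧
      ∀ x, T x = x + (B x (p - r) / B p r) • (p - r) := by
  let f : V →ₗ[ℂ] V := LinearMap.id + (B.flip (p - r)).smulRight ((B p r)⁻¹ • (p - r))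
  have hf : ∀ x, f x = x + (B x (p - r) / B p r) • (p - r) := fun x => by
    simp [f, smul_smul, div_eq_mul_inv]
  have hv : B (p - r) (p - r) = -2 * B p r := by
    simp only [map_sub, LinearMap.sub_apply, hp, hr, hsymm r p]; ring
  refine ⟨LinearEquiv.ofInvolutive f fun x => ?_, fun x y => ?_, hf⟩
  · rw [hf (f x), hf x]
    generalize p - r = v at *
    simp only [map_add, map_smul, LinearMap.add_apply, LinearMap.smul_apply, smul_eq_mul, hv]
    match_scalars
    · rfl
    · field_simp
      ring
  · change B (f x) (f y) = _
    rw [hf, hf]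
    generalize p - r = v at *
    simp only [map_add, map_smul, LinearMap.add_apply, LinearMap.smul_apply, smul_eq_mul, hv,
      hsymm v y]
    field_simp
    ring

/-- Independent vectors `X0`, `X1` admit dual vectors `u`, `v` for a nondegenerate form. -/
theorem exists_dual_pair {B : LinearMap.BilinForm ℂ V} (hB : B.Nondegenerate)
    {X0 X1 Y0 : V} (hXY : B X0 Y0 = 1) (hX1 : ∀ c : ℂ, X1 ≠ c • X0) :
    ∃ u v : V, B X0 u = 1 ∧ B X1 u = 0 ∧ B X0 v = 0 ∧ B X1 v = 1 := by
  have h : ∃ v, B X0 v = 0 ∧ B X1 v ≠ 0 := by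
    by_contra! h
    refine hX1 (B X1 Y0) (eq_of_forall_form_eq hB fun z => ?_)
    have := h (z - B X0 z • Y0) (by simp [hXY])
    simp only [map_sub, map_smul, smul_eq_mul] at this
    simp only [map_smul, LinearMap.smul_apply, smul_eq_mul]
    linear_combination this
  obtain ⟨v, hv0, hv1⟩ := h
  refine ⟨Y0 - (B X1 Y0 / B X1 v) • v, (B X1 v)⁻¹ • v, ?_, ?_, ?_, ?_⟩ <;>
    simp [hXY, hv0, hv1]

end SymmetricForm

theorem mem_orthoPair {g : Type*} [LieRing g] [LieAlgebra ℂ g]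
    {B : LinearMap.BilinForm ℂ g} {X0 Y0 x : g} :
    x ∈ orthoPair B X0 Y0 ↔ B x X0 = 0 ∧ B x Y0 = 0 := by
  simp [orthoPair]

section QuadraticLieAlgebra

variable {g : Type*} [LieRing g] [LieAlgebra ℂ g] {B : LinearMap.BilinForm ℂ g}

theorem form_lie_self_left
    (hinv : ∀ x y z : g, B ⁅x, y⁆ z = B x ⁅y, z⁆) (x y : g) : B ⁅x, y⁆ x = 0 := by
  have h := hinv y x x
  rw [lie_self, map_zero] at h
  rw [← lie_skew, map_neg, LinearMap.neg_apply, h, neg_zero]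

theorem form_lie_self_right (hinv : ∀ x y z : g, B ⁅x, y⁆ z = B x ⁅y, z⁆) (x y : g) :
    B ⁅x, y⁆ y = 0 := by
  rw [hinv, lie_self, map_zero]

/-- The vector `X0` of double-extension data is central. -/
theorem lie_eq_zero_of_doubleExtension
    {X0 Y0 : g} (hX0 : B X0 X0 = 0)
    (hYX : ⁅Y0, X0⁆ = 0)
    (hbracket : ∀ X Y : g,
      ⁅X, Y⁆ = B X0 X • ⁅Y0, Y⁆ - B X0 Y • ⁅Y0, X⁆ + B ⁅Y0, X⁆ Y • X0) (x : g) :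
    ⁅X0, x⁆ = 0 := by
  rw [hbracket, hX0, hYX]; simp

/-- If brackets in `X0ᗮ` are multiples of `X0` and those in `X1ᗮ` are multiples of `X1`, for two
independent vectors, then the invariant three-form is decomposable. -/
theorem lie_eq_of_two_hyperplanes (hB : B.Nondegenerate) (hsymm : ∀ x y : g, B x y = B y x)
    (hinv : ∀ x y z : g, B ⁅x, y⁆ z = B x ⁅y, z⁆) {X0 X1 u v : g}
    (hu0 : B X0 u = 1) (hu1 : B X1 u = 0) (hv0 : B X0 v = 0) (hv1 : B X1 v = 1)
    (h0 : ∀ x y, B X0 x = 0 → B X0 y = 0 → ∃ c : ℂ, ⁅x, y⁆ = c • X0)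
    (h1 : ∀ x y, B X1 x = 0 → B X1 y = 0 → ∃ c : ℂ, ⁅x, y⁆ = c • X1) (x y : g) :
    ⁅x, y⁆ = (B X0 x * B X1 y - B X1 x * B X0 y) • ⁅u, v⁆
      + (B X1 x * B ⁅u, v⁆ y - B X1 y * B ⁅u, v⁆ x) • X0
      + (B ⁅u, v⁆ x * B X0 y - B ⁅u, v⁆ y * B X0 x) • X1 := by
  have hwu := form_lie_self_left hinv u v
  have hwv := form_lie_self_right hinv u v
  have hdec : ∀ z : g, ∃ k, z = B X0 z • u + B X1 z • v + k ∧ B X0 k = 0 ∧ B X1 k = 0 ∧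
      B ⁅u, v⁆ z = B ⁅u, v⁆ k := fun z =>
    ⟨z - B X0 z • u - B X1 z • v, by abel, by simp [hu0, hv0], by simp [hu1, hv1],
      by simp [hwu, hwv]⟩
  have hkk : ∀ k l, B X0 k = 0 → B X1 k = 0 → B X0 l = 0 → B X1 l = 0 → ⁅k, l⁆ = 0 := by
    intro k l hk0 hk1 hl0 hl1
    obtain ⟨c, hc⟩ := h0 k l hk0 hl0
    obtain ⟨d, hd⟩ := h1 k l hk1 hl1
    have := congrArg (fun t => B t v) (hc.symm.trans hd)
    simp [hv0, hv1] at this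
    rw [hd, ← this, zero_smul]
  have huk : ∀ k, B X0 k = 0 → B X1 k = 0 → ⁅u, k⁆ = (-B ⁅u, v⁆ k) • X1 := by
    intro k hk0 hk1
    refine eq_of_forall_form_eq hB fun z => ?_
    obtain ⟨l, hz, hl0, hl1, -⟩ := hdec z
    have e1 : B ⁅u, k⁆ l = 0 := by rw [hinv, hkk k l hk0 hk1 hl0 hl1, map_zero]
    have e2 : B ⁅u, k⁆ v = -B ⁅u, v⁆ k := by
      rw [hinv, hinv, ← lie_skew, map_neg]
    have e3 := form_lie_self_left hinv u k
    rw [hz]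
    simp [e1, e2, e3, hu1, hv1, hl1, mul_comm]
  have hvk : ∀ k, B X0 k = 0 → B X1 k = 0 → ⁅v, k⁆ = B ⁅u, v⁆ k • X0 := by
    intro k hk0 hk1
    refine eq_of_forall_form_eq hB fun z => ?_
    obtain ⟨l, hz, hl0, hl1, -⟩ := hdec z
    have e1 : B ⁅v, k⁆ l = 0 := by rw [hinv, hkk k l hk0 hk1 hl0 hl1, map_zero]
    have e2 : B ⁅v, k⁆ u = B ⁅u, v⁆ k := by rw [hsymm, hinv]
    have e3 := form_lie_self_left hinv v k
    rw [hz]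
    simp [e1, e2, e3, hu0, hv0, hl0, mul_comm]
  obtain ⟨k, hx, hk0, hk1, hwk⟩ := hdec x
  obtain ⟨l, hy, hl0, hl1, hwl⟩ := hdec y
  rw [hwk, hwl]
  have : ⁅x, y⁆ = ⁅B X0 x • u + B X1 x • v + k, B X0 y • u + B X1 y • v + l⁆ := by
    rw [← hx, ← hy]
  rw [this]
  have hvu : ⁅v, u⁆ = -⁅u, v⁆ := (lie_skew _ _).symm
  have hku : ⁅k, u⁆ = -⁅u, k⁆ := (lie_skew _ _).symm
  have hkv : ⁅k, v⁆ = -⁅v, k⁆ := (lie_skew _ _).symm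
  simp only [lie_add, add_lie, lie_smul, smul_lie, lie_self, hvu, hku, hkv, huk k hk0 hk1,
    huk l hl0 hl1, hvk k hk0 hk1, hvk l hl0 hl1, hkk k l hk0 hk1 hl0 hl1]
  module

/-- Two independent central isotropic vectors, each spanning the brackets of its orthogonal
hyperplane, are related by an isometric automorphism. -/
theorem exists_isometric_automorphism (hB : B.Nondegenerate) (hsymm : ∀ x y : g, B x y = B y x)
    (hinv : ∀ x y z : g, B ⁅x, y⁆ z = B x ⁅y, z⁆) {X0 X1 u v : g}
    (hu0 : B X0 u = 1) (hu1 : B X1 u = 0) (hv0 : B X0 v = 0) (hv1 : B X1 v = 1)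
    (h0 : ∀ x y, B X0 x = 0 → B X0 y = 0 → ∃ c : ℂ, ⁅x, y⁆ = c • X0)
    (h1 : ∀ x y, B X1 x = 0 → B X1 y = 0 → ∃ c : ℂ, ⁅x, y⁆ = c • X1)
    (hX0 : B X0 X0 = 0) (hX1 : B X1 X1 = 0)
    (hc0 : ∀ x : g, ⁅X0, x⁆ = 0) (hc1 : ∀ x : g, ⁅X1, x⁆ = 0) :
    ∃ T : g ≃ₗ⁅ℂ⁆ g, (∀ x y, B (T x) (T y) = B x y) ∧ T X0 = X1 := by
  have hlie := lie_eq_of_two_hyperplanes hB hsymm hinv hu0 hu1 hv0 hv1 h0 h1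
  have hwu := form_lie_self_left hinv u v
  have hwv := form_lie_self_right hinv u v
  have hw0 : B ⁅u, v⁆ X0 = 0 := by rw [hsymm, ← hinv, hc0, map_zero, LinearMap.zero_apply]
  have hw1 : B ⁅u, v⁆ X1 = 0 := by rw [hsymm, ← hinv, hc1, map_zero, LinearMap.zero_apply]
  suffices h : ∃ T : g ≃ₗ[ℂ] g, (∀ x y, B (T x) (T y) = B x y) ∧ T X0 = X1 ∧
      ∀ x y, T ⁅x, y⁆ = ⁅T x, T y⁆ by
    obtain ⟨T, hT, hTX, hTl⟩ := h
    exact ⟨{ T with map_lie' := fun {x y} => hTl x y }, hT, hTX⟩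
  generalize ⁅u, v⁆ = w at *
  by_cases hb : B X0 X1 = 0
  · have hb' : B X1 X0 = 0 := by rw [hsymm, hb]
    obtain ⟨Z, hZ0, hZ1, hwZ, hZZ⟩ :
        ∃ Z, B X0 Z = 1 ∧ B X1 Z = 1 ∧ B w Z = 0 ∧ B Z Z = 0 := by
      refine ⟨u + v - (B (u + v) (u + v) / 2) • X0, ?_, ?_, ?_, ?_⟩
      · simp [hu0, hv0, hX0]
      · simp [hu1, hv1, hb']
      · simp [hwu, hwv, hw0]
      · have e : B (u + v) X0 = 1 := by rw [hsymm]; simp [hu0, hv0]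
        have e' : B X0 (u + v) = 1 := by simp [hu0, hv0]
        generalize u + v = s at *
        simp only [map_sub, map_smul, LinearMap.sub_apply, LinearMap.smul_apply, smul_eq_mul,
          e, e', hX0]
        ring
    have hZ0' : B Z X0 = 1 := by rw [hsymm, hZ0]
    have hZ1' : B Z X1 = 1 := by rw [hsymm, hZ1]
    obtain ⟨S, hS, hSx⟩ := exists_reflection_swap hsymm hX0 hZZ (by simp [hZ0])
    obtain ⟨R, hR, hRx⟩ := exists_reflection_swap hsymm hZZ hX1 (by simp [hZ1'])
    have hT : ∀ x y, B ((S.trans R) x) ((S.trans R) y) = B x y := fun x y => by simp [hS, hR]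
    have hT0 : (S.trans R) X0 = X1 := by
      simp only [LinearEquiv.trans_apply, hSx, hRx]
      simp [hX0, hZ0, hZ1', hZZ]
    have hT1 : (S.trans R) X1 = (2 : ℂ) • X1 - X0 := by
      simp only [LinearEquiv.trans_apply, hSx, hRx]
      simp [hX1, hZ0, hZ1, hZ1', hZZ, hb, hb']
      module
    have hTw : (S.trans R) w = w := by
      simp only [LinearEquiv.trans_apply, hSx, hRx]
      simp [hwZ, hw0, hw1]
    generalize S.trans R = T at *
    refine ⟨T, hT, hT0, fun x y => ?_⟩
    have a1 : ∀ x, B X1 (T x) = B X0 x := fun x => by rw [← hT X0 x, hT0]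
    have a0 : ∀ x, B X0 (T x) = 2 * B X0 x - B X1 x := fun x => by
      have := hT X1 x
      rw [hT1] at this
      simp [a1] at this
      linear_combination -this
    have aw : ∀ x, B w (T x) = B w x := fun x => by rw [← hT w x, hTw]
    rw [hlie x y, hlie (T x) (T y)]
    simp only [map_add, map_smul, hT0, hT1, hTw, a0, a1, aw]
    module
  · have hab : ∀ x y : g, ⁅x, y⁆ = 0 := by
      have hw : w = 0 := by
        have h := hlie u X0
        rw [← lie_skew, hc0] at h
        simp [hu0, hu1, hX0, hw0, hwu, hsymm X1 X0] at h
        exact (smul_eq_zero.1 h.symm).resolve_left hb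
      intro x y
      rw [hlie, hw]; simp
    obtain ⟨S, hS, hSx⟩ := exists_reflection_swap hsymm hX0 hX1 hb
    refine ⟨S, hS, ?_, fun x y => by simp [hab]⟩
    rw [hSx, map_sub, hX0, zero_sub, neg_div, div_self hb]
    module

end QuadraticLieAlgebra

section TwoAlgebras

variable {g g' : Type*} [LieRing g] [LieAlgebra ℂ g] [LieRing g'] [LieAlgebra ℂ g']
  {B : LinearMap.BilinForm ℂ g} {B' : LinearMap.BilinForm ℂ g'}

/-- The map `orthoPair B X0 Y0 → orthoPair B' X0' Y0'` induced by a linear map sending `X0ᗮ` to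
`X0'ᗮ`, namely its correction along `X0'`. -/
noncomputable def orthoPairMap {X0 Y0 : g} {X0' Y0' : g'} (hX0' : B' X0' X0' = 0)
    (hXY' : B' X0' Y0' = 1) (f : g →ₗ[ℂ] g') (hf : ∀ x, B x X0 = 0 → B' (f x) X0' = 0) :
    orthoPair B X0 Y0 →ₗ[ℂ] orthoPair B' X0' Y0' :=
  LinearMap.codRestrict _
    ((f - ((B'.flip Y0').comp f).smulRight X0').comp (orthoPair B X0 Y0).subtype)
    fun x => mem_orthoPair.2 ⟨by simp [hf x (mem_orthoPair.1 x.2).1, hX0'], by simp [hXY']⟩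

theorem coe_orthoPairMap {X0 Y0 : g} {X0' Y0' : g'} (hX0' : B' X0' X0' = 0)
    (hXY' : B' X0' Y0' = 1) (f : g →ₗ[ℂ] g') (hf : ∀ x, B x X0 = 0 → B' (f x) X0' = 0)
    (x : orthoPair B X0 Y0) :
    (orthoPairMap (Y0 := Y0) hX0' hXY' f hf x : g') = f x - B' (f x) Y0' • X0' :=
  rfl

theorem orthoPairMap_comp_eq {X0 Y0 : g} {X0' Y0' : g'} (hX0 : B X0 X0 = 0) (hXY : B X0 Y0 = 1)
    (hX0' : B' X0' X0' = 0) (hXY' : B' X0' Y0' = 1) (f : g →ₗ[ℂ] g') (f' : g' →ₗ[ℂ] g)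
    (hf : ∀ x, B x X0 = 0 → B' (f x) X0' = 0) (hf' : ∀ x, B' x X0' = 0 → B (f' x) X0 = 0)
    (hff : ∀ x, f' (f x) = x) {d : ℂ} (hd : f' X0' = d • X0) (x : orthoPair B X0 Y0) :
    orthoPairMap (Y0 := Y0') hX0 hXY f' hf' (orthoPairMap (Y0 := Y0) hX0' hXY' f hf x) = x := by
  apply Subtype.ext
  rw [coe_orthoPairMap, coe_orthoPairMap]
  simp [hff, hd, hXY, (mem_orthoPair.1 x.2).2, smul_smul]

/-- An isometric isomorphism mapping `X0` to a multiple of `X0'` induces an isometry of the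
orthogonal complements which intertwines `ad Y0` and `ad Y0'` up to a scalar. -/
theorem exists_conjugation_of_map_eq_smul
    (hsymm' : ∀ x y : g', B' x y = B' y x)
    (hinv' : ∀ x y z : g', B' ⁅x, y⁆ z = B' x ⁅y, z⁆)
    {X0 Y0 : g} {X0' Y0' : g'}
    (hX0 : B X0 X0 = 0) (hXY : B X0 Y0 = 1)
    (hX0' : B' X0' X0' = 0) (hXY' : B' X0' Y0' = 1)
    (hYX' : ⁅Y0', X0'⁆ = 0)
    (hbracket' : ∀ X Y : g',
      ⁅X, Y⁆ = B' X0' X • ⁅Y0', Y⁆ - B' X0' Y • ⁅Y0', X⁆ + B' ⁅Y0', X⁆ Y • X0')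
    (hq : ∀ x : g, x ∈ orthoPair B X0 Y0 → ⁅Y0, x⁆ ∈ orthoPair B X0 Y0)
    (A : g ≃ₗ⁅ℂ⁆ g') (hA : ∀ x y : g, B' (A x) (A y) = B x y)
    {c : ℂ} (hc : c ≠ 0) (hAX : A X0 = c • X0') :
    ∃ Abar : (orthoPair B X0 Y0) ≃ₗ[ℂ] (orthoPair B' X0' Y0'),
      (∀ x y : orthoPair B X0 Y0, B' (Abar x : g') (Abar y : g') = B (x : g) (y : g)) ∧
      (∀ x : orthoPair B X0 Y0,
        ⁅Y0', (Abar x : g')⁆ =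
          c • ((Abar ⟨⁅Y0, (x : g)⁆, hq _ x.2⟩ : orthoPair B' X0' Y0') : g')) := by
  have hcX : ∀ x, c * B' (A x) X0' = B x X0 := fun x => by rw [← hA x X0, hAX]; simp
  have hf : ∀ x, B x X0 = 0 → B' (A x) X0' = 0 := fun x hx => by
    have := hcX x
    rw [hx] at this
    exact (mul_eq_zero.1 this).resolve_left hc
  have hf' : ∀ x, B' x X0' = 0 → B (A.symm x) X0 = 0 := fun x hx => by
    rw [← hcX, LieEquiv.apply_symm_apply, hx, mul_zero]
  have hAX' : A.symm X0' = c⁻¹ • X0 := by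
    apply A.injective
    change A _ = A _
    rw [LieEquiv.apply_symm_apply, map_smul, hAX, smul_smul, inv_mul_cancel₀ hc, one_smul]
  have hAX2 : A X0 = c⁻¹⁻¹ • X0' := by rw [hAX, inv_inv]
  let F := orthoPairMap (Y0 := Y0) hX0' hXY' (A.toLinearEquiv : g →ₗ[ℂ] g') hf
  let F' := orthoPairMap (Y0 := Y0') hX0 hXY (A.symm.toLinearEquiv : g' →ₗ[ℂ] g) hf'
  have hF : ∀ x, (F x : g') = A x - B' (A x) Y0' • X0' := fun x => rfl
  let e : orthoPair B X0 Y0 ≃ₗ[ℂ] orthoPair B' X0' Y0' :=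
    LinearEquiv.ofLinearMap F F'
      (LinearMap.ext fun x => orthoPairMap_comp_eq hX0' hXY' hX0 hXY _ _ hf' hf
        (fun x => A.apply_symm_apply x) hAX x)
      (LinearMap.ext fun x => orthoPairMap_comp_eq hX0 hXY hX0' hXY' _ _ hf hf'
        (fun x => A.symm_apply_apply x) hAX' x)
  refine ⟨e, fun x y => ?_, fun x => ?_⟩
  · change B' (F x) (F y) = _
    have hx := hf x (mem_orthoPair.1 x.2).1
    have hy := hf y (mem_orthoPair.1 y.2).1
    rw [hsymm'] at hy
    simp [hF, hA, hx, hy, hX0']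
  · change ⁅Y0', (F x : g')⁆ = c • (F _ : g')
    have hx := hf x (mem_orthoPair.1 x.2).1
    rw [hsymm'] at hx
    have hY : c * B' X0' (A Y0) = 1 := by rw [hsymm', hcX, ← hXY, ← hA, ← hA, hsymm']
    have hl : A ⁅Y0, (x : g)⁆ = ⁅A Y0, A x⁆ := LieEquiv.map_lie A _ _
    have hY0 : B' ⁅Y0', A x⁆ Y0' = 0 := form_lie_self_left hinv' _ _
    rw [hF, hF]
    simp only [lie_sub, lie_smul, hYX', smul_zero, sub_zero, hl]
    rw [hbracket' (A Y0) (A x), hx]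
    simp only [map_add, map_smul, LinearMap.add_apply,
      LinearMap.smul_apply, smul_eq_mul, hY0, hXY', zero_smul, sub_zero, mul_zero, mul_one,
      zero_add, add_sub_cancel_right, smul_smul, hY, one_smul]

/-- An isometry of the orthogonal complements intertwining `ad Y0` and `ad Y0'` up to a scalar
extends to an isometric isomorphism. -/
theorem exists_isometric_lieEquiv_of_conjugation
    (hsymm : ∀ x y : g, B x y = B y x) (hsymm' : ∀ x y : g', B' x y = B' y x)
    {X0 Y0 : g} {X0' Y0' : g'}
    (hX0 : B X0 X0 = 0) (hY0 : B Y0 Y0 = 0) (hXY : B X0 Y0 = 1)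
    (hYX : ⁅Y0, X0⁆ = 0)
    (hbracket : ∀ X Y : g,
      ⁅X, Y⁆ = B X0 X • ⁅Y0, Y⁆ - B X0 Y • ⁅Y0, X⁆ + B ⁅Y0, X⁆ Y • X0)
    (hX0' : B' X0' X0' = 0) (hY0' : B' Y0' Y0' = 0) (hXY' : B' X0' Y0' = 1)
    (hYX' : ⁅Y0', X0'⁆ = 0)
    (hbracket' : ∀ X Y : g',
      ⁅X, Y⁆ = B' X0' X • ⁅Y0', Y⁆ - B' X0' Y • ⁅Y0', X⁆ + B' ⁅Y0', X⁆ Y • X0')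
    (hq : ∀ x : g, x ∈ orthoPair B X0 Y0 → ⁅Y0, x⁆ ∈ orthoPair B X0 Y0)
    {lam : ℂ} (hlam : lam ≠ 0) (e : (orthoPair B X0 Y0) ≃ₗ[ℂ] (orthoPair B' X0' Y0'))
    (he : ∀ x y : orthoPair B X0 Y0, B' (e x : g') (e y : g') = B (x : g) (y : g))
    (hel : ∀ x : orthoPair B X0 Y0,
      ⁅Y0', (e x : g')⁆ = lam • ((e ⟨⁅Y0, (x : g)⁆, hq _ x.2⟩ : orthoPair B' X0' Y0') : g')) :
    ∃ A : g ≃ₗ⁅ℂ⁆ g', ∀ x y : g, B' (A x) (A y) = B x y := by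
  have hYX1 : B Y0 X0 = 1 := by rw [hsymm, hXY]
  have hYX1' : B' Y0' X0' = 1 := by rw [hsymm', hXY']
  let P : g →ₗ[ℂ] orthoPair B X0 Y0 := LinearMap.codRestrict _
    (LinearMap.id - (B Y0).smulRight X0 - (B X0).smulRight Y0) fun x =>
      mem_orthoPair.2 ⟨by simp [hsymm x X0, hX0, hYX1], by simp [hsymm x Y0, hXY, hY0]⟩
  have hP : ∀ x, (P x : g) = x - B Y0 x • X0 - B X0 x • Y0 := fun x => rfl
  have hPq : ∀ x : orthoPair B X0 Y0, P x = x := fun x => by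
    apply Subtype.ext
    have h := mem_orthoPair.1 x.2
    rw [hP, hsymm Y0, hsymm X0, h.1, h.2]; simp
  let P' : g' →ₗ[ℂ] orthoPair B' X0' Y0' := LinearMap.codRestrict _
    (LinearMap.id - (B' Y0').smulRight X0' - (B' X0').smulRight Y0') fun x =>
      mem_orthoPair.2 ⟨by simp [hsymm' x X0', hX0', hYX1'], by simp [hsymm' x Y0', hXY', hY0']⟩
  have hP' : ∀ x, (P' x : g') = x - B' Y0' x • X0' - B' X0' x • Y0' := fun x => rfl
  have hPq' : ∀ x : orthoPair B' X0' Y0', P' x = x := fun x => by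
    apply Subtype.ext
    have h := mem_orthoPair.1 x.2
    rw [hP', hsymm' Y0', hsymm' X0', h.1, h.2]; simp
  have hdec : ∀ x, ∃ (a b : ℂ) (k : orthoPair B X0 Y0), x = a • X0 + b • Y0 + k := fun x =>
    ⟨B Y0 x, B X0 x, P x, by rw [hP]; abel⟩
  have hdec' : ∀ x, ∃ (a b : ℂ) (k : orthoPair B' X0' Y0'), x = a • X0' + b • Y0' + k := fun x =>
    ⟨B' Y0' x, B' X0' x, P' x, by rw [hP']; abel⟩
  let f : g →ₗ[ℂ] g' := (lam • B Y0).smulRight X0' + (lam⁻¹ • B X0).smulRight Y0' +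
    (orthoPair B' X0' Y0').subtype ∘ₗ e.toLinearMap ∘ₗ P
  let f' : g' →ₗ[ℂ] g := (lam⁻¹ • B' Y0').smulRight X0 + (lam • B' X0').smulRight Y0 +
    (orthoPair B X0 Y0).subtype ∘ₗ e.symm.toLinearMap ∘ₗ P'
  have hfx : ∀ x, f x = (lam * B Y0 x) • X0' + (lam⁻¹ * B X0 x) • Y0' + e (P x) := fun x => rfl
  have hfx' : ∀ x, f' x = (lam⁻¹ * B' Y0' x) • X0 + (lam * B' X0' x) • Y0 + e.symm (P' x) :=
    fun x => rfl
  have hPX : P X0 = 0 := Subtype.ext (by simp [hP, hX0, hYX1])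
  have hPY : P Y0 = 0 := Subtype.ext (by simp [hP, hXY, hY0])
  have hPX' : P' X0' = 0 := Subtype.ext (by simp [hP', hX0', hYX1'])
  have hPY' : P' Y0' = 0 := Subtype.ext (by simp [hP', hXY', hY0'])
  have kX : ∀ k : orthoPair B X0 Y0, B X0 k = 0 := fun k => by
    rw [hsymm]; exact (mem_orthoPair.1 k.2).1
  have kY : ∀ k : orthoPair B X0 Y0, B Y0 k = 0 := fun k => by
    rw [hsymm]; exact (mem_orthoPair.1 k.2).2
  have kX' : ∀ k : orthoPair B' X0' Y0', B' X0' k = 0 := fun k => by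
    rw [hsymm']; exact (mem_orthoPair.1 k.2).1
  have kY' : ∀ k : orthoPair B' X0' Y0', B' Y0' k = 0 := fun k => by
    rw [hsymm']; exact (mem_orthoPair.1 k.2).2
  have fX : f X0 = lam • X0' := by simp [hfx, hX0, hYX1, hPX]
  have fY : f Y0 = lam⁻¹ • Y0' := by simp [hfx, hY0, hXY, hPY]
  have fk : ∀ k : orthoPair B X0 Y0, f k = e k := fun k => by simp [hfx, kX, kY, hPq]
  have fX' : f' X0' = lam⁻¹ • X0 := by simp [hfx', hX0', hYX1', hPX']
  have fY' : f' Y0' = lam • Y0 := by simp [hfx', hY0', hXY', hPY']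
  have fk' : ∀ k : orthoPair B' X0' Y0', f' k = e.symm k := fun k => by
    simp [hfx', kX', kY', hPq']
  have hff : ∀ x, f' (f x) = x := fun x => by
    obtain ⟨a, b, k, rfl⟩ := hdec x
    simp [fX, fY, fk, fX', fY', fk', smul_smul, hlam]
  have hff' : ∀ x, f (f' x) = x := fun x => by
    obtain ⟨a, b, k, rfl⟩ := hdec' x
    simp [fX, fY, fk, fX', fY', fk', smul_smul, hlam]
  have hiso : ∀ x y, B' (f x) (f y) = B x y := fun x y => by
    rw [hfx, hfx]
    have h := he (P x) (P y)
    rw [hP, hP] at h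
    have e1 := fun k => (mem_orthoPair.1 (e k).2).1
    have e2 := fun k => (mem_orthoPair.1 (e k).2).2
    simp only [map_add, map_sub, map_smul, LinearMap.add_apply, LinearMap.sub_apply,
      LinearMap.smul_apply, smul_eq_mul, hX0, hY0, hXY, hX0', hY0', hXY', hYX1, hYX1', kX', kY',
      e1, e2, h, hsymm x X0, hsymm x Y0]
    field_simp
    ring
  have hfY : ∀ x, f ⁅Y0, x⁆ = lam⁻¹ • ⁅Y0', f x⁆ := fun x => by
    obtain ⟨a, b, k, rfl⟩ := hdec x
    have := fk ⟨⁅Y0, (k : g)⁆, hq _ k.2⟩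
    simp only [lie_add, lie_smul, map_add, map_smul, hYX, hYX', lie_self, smul_zero, fX, fY, fk,
      hel, zero_add, smul_smul, inv_mul_cancel₀ hlam, one_smul]
    exact this
  have hfl : ∀ x y, f ⁅x, y⁆ = ⁅f x, f y⁆ := fun x y => by
    have hX : ∀ z, B X0 z = lam * B' X0' (f z) := fun z => by
      rw [← hiso X0 z, fX]; simp
    rw [hbracket x y, hbracket' (f x) (f y), ← hiso ⁅Y0, x⁆ y]
    simp only [map_add, map_sub, map_smul, hfY, fX, hX, LinearMap.smul_apply, smul_eq_mul,
      smul_smul]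
    match_scalars <;> field_simp
  let E : g ≃ₗ[ℂ] g' := LinearEquiv.ofLinearMap f f' (LinearMap.ext hff') (LinearMap.ext hff)
  exact ⟨{ E with map_lie' := fun {x y} => hfl x y }, hiso⟩

end TwoAlgebras

/-- Let `(g,B)` and `(g',B')` be quadratic Lie algebras with
double-extension data `(X0,Y0)` and `(X0',Y0')`, and let `q`, `q'` be the orthogonals of
`span{X0,Y0}`, `span{X0',Y0'}` (which are stable under `ad Y0`, resp. `ad Y0'`).
Then `g` and `g'` are i-isomorphic if and only if there are a nonzero `λ ∈ ℂ` and a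
linear isometry `Ā : q → q'` with `[Y0', Ā x] = λ • Ā [Y0, x]` for all `x ∈ q`. -/
theorem i_isomorphic_iff_conjugate
    {g g' : Type*} [LieRing g] [LieAlgebra ℂ g] [Module.Finite ℂ g]
    [LieRing g'] [LieAlgebra ℂ g'] [Module.Finite ℂ g']
    (B : LinearMap.BilinForm ℂ g) (B' : LinearMap.BilinForm ℂ g')
    (hsymm : ∀ x y : g, B x y = B y x)
    (hnondeg : B.Nondegenerate)
    (hinv : ∀ x y z : g, B ⁅x, y⁆ z = B x ⁅y, z⁆)
    (hsymm' : ∀ x y : g', B' x y = B' y x)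
    (hnondeg' : B'.Nondegenerate)
    (hinv' : ∀ x y z : g', B' ⁅x, y⁆ z = B' x ⁅y, z⁆)
    (X0 Y0 : g) (X0' Y0' : g')
    (hX0 : B X0 X0 = 0) (hY0 : B Y0 Y0 = 0) (hXY : B X0 Y0 = 1)
    (hYX : ⁅Y0, X0⁆ = 0)
    (hbracket : ∀ X Y : g,
      ⁅X, Y⁆ = B X0 X • ⁅Y0, Y⁆ - B X0 Y • ⁅Y0, X⁆ + B ⁅Y0, X⁆ Y • X0)
    (hX0' : B' X0' X0' = 0) (hY0' : B' Y0' Y0' = 0) (hXY' : B' X0' Y0' = 1)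
    (hYX' : ⁅Y0', X0'⁆ = 0)
    (hbracket' : ∀ X Y : g',
      ⁅X, Y⁆ = B' X0' X • ⁅Y0', Y⁆ - B' X0' Y • ⁅Y0', X⁆ + B' ⁅Y0', X⁆ Y • X0')
    (hq : ∀ x : g, x ∈ orthoPair B X0 Y0 → ⁅Y0, x⁆ ∈ orthoPair B X0 Y0)
    (hq' : ∀ x : g', x ∈ orthoPair B' X0' Y0' → ⁅Y0', x⁆ ∈ orthoPair B' X0' Y0') :
    (∃ A : g ≃ₗ⁅ℂ⁆ g', ∀ x y : g, B' (A x) (A y) = B x y) ↔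
      (∃ lam : ℂ, lam ≠ 0 ∧
        ∃ Abar : (orthoPair B X0 Y0) ≃ₗ[ℂ] (orthoPair B' X0' Y0'),
          (∀ x y : orthoPair B X0 Y0, B' (Abar x : g') (Abar y : g') = B (x : g) (y : g)) ∧
          (∀ x : orthoPair B X0 Y0,
            ⁅Y0', (Abar x : g')⁆ =
              lam • ((Abar ⟨⁅Y0, (x : g)⁆, hq _ x.2⟩ : orthoPair B' X0' Y0') : g'))) := by
  constructor
  · rintro ⟨A, hA⟩
    have hA' : ∀ (x : g') (y : g), B (A.symm x) y = B' x (A y) := fun x y => by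
      rw [← hA, LieEquiv.apply_symm_apply]
    suffices h : ∃ (A : g ≃ₗ⁅ℂ⁆ g') (c : ℂ), (∀ x y, B' (A x) (A y) = B x y) ∧ c ≠ 0 ∧
        A X0 = c • X0' by
      obtain ⟨A, c, hA, hc, hAX⟩ := h
      exact ⟨c, hc, exists_conjugation_of_map_eq_smul hsymm' hinv' hX0 hXY hX0' hXY' hYX'
        hbracket' hq A hA hc hAX⟩
    by_cases hdep : ∃ c : ℂ, A.symm X0' = c • X0
    · obtain ⟨c, hc⟩ := hdep
      have hAc : X0' = c • A X0 := by rw [← map_smul, ← hc, LieEquiv.apply_symm_apply]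
      have hc0 : c ≠ 0 := by
        rintro rfl
        rw [zero_smul] at hAc
        simp [hAc] at hXY'
      refine ⟨A, c⁻¹, hA, inv_ne_zero hc0, ?_⟩
      rw [hAc, smul_smul, inv_mul_cancel₀ hc0, one_smul]
    · push Not at hdep
      obtain ⟨u, v, hu0, hu1, hv0, hv1⟩ := exists_dual_pair hnondeg hXY hdep
      obtain ⟨T, hT, hTX⟩ := exists_isometric_automorphism hnondeg hsymm hinv hu0 hu1 hv0 hv1
        (fun x y hx hy => ⟨B ⁅Y0, x⁆ y, by rw [hbracket, hx, hy]; simp⟩)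
        (fun x y hx hy => ⟨B' ⁅Y0', A x⁆ (A y), by
          rw [hA'] at hx hy
          apply A.injective
          change A _ = A _
          rw [LieEquiv.map_lie, map_smul, LieEquiv.apply_symm_apply, hbracket', hx, hy]
          simp⟩)
        hX0 (by rw [hA', LieEquiv.apply_symm_apply, hX0'])
        (lie_eq_zero_of_doubleExtension hX0 hYX hbracket)
        (fun x => A.injective (by
          change A _ = A _
          rw [LieEquiv.map_lie, LieEquiv.apply_symm_apply, map_zero,
            lie_eq_zero_of_doubleExtension hX0' hYX' hbracket']))
      refine ⟨T.trans A, 1, fun x y => ?_, one_ne_zero, ?_⟩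
      · rw [LieEquiv.trans_apply, LieEquiv.trans_apply, hA, hT]
      · rw [LieEquiv.trans_apply, hTX, LieEquiv.apply_symm_apply, one_smul]
  · rintro ⟨lam, hlam, e, he, hel⟩
    exact exists_isometric_lieEquiv_of_conjugation hsymm hsymm' hX0 hY0 hXY hYX hbracket
      hX0' hY0' hXY' hYX' hbracket' hq hlam e he hel
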